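/- Simplified variational expression under the symmetry assumption: suppose V : Ω → Ω is invertible, measure-preserving and ergodic, the ℤ^d-action is V_z = V^{z_1+⋯+z_d}, the stationary edge-weights satisfy the undirected condition τ(x,α,ω) = τ(x+α,−α,ω) for all x, α and a.e. ω, and a ≤ τ ≤ b. Then for every φ ∈ S, writing f(ω) = φ(e_1,ω) − φ(0,ω), one has esssup_{ω∈Ω} sup_{x∈ℤ^d} 𝓗(φ,p,x,ω) = esssup_{ω∈Ω} max_{1≤i≤d} |f(ω) + p·e_i| / τ(0,e_i,ω). -/

import Mathlib

open MeasureTheory Filter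

noncomputable section

/-- The set `A` of signed standard basis vectors of `ℤ^d`. -/
def dirs (d : ℕ) : Finset (Fin d → ℤ) :=
  Finset.univ.image (fun ib : Fin d × Bool =>
    if ib.2 then Pi.single ib.1 1 else -Pi.single ib.1 1)

/-- The inner product `p·α` of `p ∈ ℝ^d` with a lattice vector `α ∈ ℤ^d`. -/
def pdot {d : ℕ} (p : Fin d → ℝ) (α : Fin d → ℤ) : ℝ := ∑ i, p i * (α i : ℝ)

/-- The `ℓ∞` norm of `p ∈ ℝ^d`. -/
def linf {d : ℕ} (p : Fin d → ℝ) : ℝ := ⨆ i, |p i|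

/-- The `ℓ¹` norm of a lattice point. -/
def zl1 {d : ℕ} (x : Fin d → ℤ) : ℝ := ∑ i, |(x i : ℝ)|

/-- The discrete Hamiltonian `𝓗(φ,p,x) = max_{α∈A} (−𝒟φ(x,α) − p·α)/τ(x,α)`. -/
def ham {d : ℕ} (τ : (Fin d → ℤ) → (Fin d → ℤ) → ℝ) (p : Fin d → ℝ)
    (φ : (Fin d → ℤ) → ℝ) (x : Fin d → ℤ) : ℝ :=
  sSup {r : ℝ | ∃ α ∈ dirs d, r = (-(φ (x + α) - φ x) - pdot p α) / τ x α}

/-- `v` is a nearest-neighbor path of length `k` starting at `x`. -/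
def IsPath {d : ℕ} (x : Fin d → ℤ) (k : ℕ) (v : ℕ → Fin d → ℤ) : Prop :=
  v 0 = x ∧ ∀ i < k, v (i + 1) - v i ∈ dirs d

/-- Total weight (travel time) of the first `k` steps of a path. -/
def pathWeight {d : ℕ} (τ : (Fin d → ℤ) → (Fin d → ℤ) → ℝ) (k : ℕ)
    (v : ℕ → Fin d → ℤ) : ℝ :=
  ∑ i ∈ Finset.range k, τ (v i) (v (i + 1) - v i)

/-- Total running cost `Σ p·(v_{i+1} − v_i)` of the first `k` steps of a path. -/
def pathCost {d : ℕ} (p : Fin d → ℝ) (k : ℕ) (v : ℕ → Fin d → ℤ) : ℝ :=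
  ∑ i ∈ Finset.range k, pdot p (v (i + 1) - v i)

/-- The discrete finite time-horizon value function `μ(x,t)`. -/
def valueFn {d : ℕ} (τ : (Fin d → ℤ) → (Fin d → ℤ) → ℝ) (p : Fin d → ℝ)
    (φ : (Fin d → ℤ) → ℝ) (x : Fin d → ℤ) (t : ℝ) : ℝ :=
  sInf {r : ℝ | ∃ (k : ℕ) (v : ℕ → Fin d → ℤ), IsPath x k v ∧
    pathWeight τ k v ≤ t ∧ r = pathCost p k v + φ (v k)}

theorem single_mem_dirs {d : ℕ} (i : Fin d) : (Pi.single i 1 : Fin d → ℤ) ∈ dirs d :=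
  Finset.mem_image.2 ⟨(i, true), Finset.mem_univ _, by simp⟩

theorem neg_single_mem_dirs {d : ℕ} (i : Fin d) : (-Pi.single i 1 : Fin d → ℤ) ∈ dirs d :=
  Finset.mem_image.2 ⟨(i, false), Finset.mem_univ _, by simp⟩

theorem exists_of_mem_dirs {d : ℕ} {α : Fin d → ℤ} (h : α ∈ dirs d) :
    ∃ i : Fin d, α = Pi.single i 1 ∨ α = -Pi.single i 1 := by
  obtain ⟨⟨i, s⟩, -, rfl⟩ := Finset.mem_image.1 h
  cases s
  · exact ⟨i, Or.inr (by simp)⟩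
  · exact ⟨i, Or.inl (by simp)⟩

theorem pdot_neg {d : ℕ} (p : Fin d → ℝ) (α : Fin d → ℤ) : pdot p (-α) = -pdot p α := by
  simp [pdot]

theorem finite_ham_set {d : ℕ} (τ : (Fin d → ℤ) → (Fin d → ℤ) → ℝ) (p : Fin d → ℝ)
    (φ : (Fin d → ℤ) → ℝ) (x : Fin d → ℤ) :
    {r : ℝ | ∃ α ∈ dirs d, r = (-(φ (x + α) - φ x) - pdot p α) / τ x α}.Finite := by
  refine ((dirs d).finite_toSet.image
    fun α => (-(φ (x + α) - φ x) - pdot p α) / τ x α).subset ?_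
  rintro r ⟨β, hβ, rfl⟩
  exact ⟨β, hβ, rfl⟩

/-- The maximum defining the discrete Hamiltonian is attained. -/
theorem exists_ham_eq {d : ℕ} (hd : 1 ≤ d) (τ : (Fin d → ℤ) → (Fin d → ℤ) → ℝ) (p : Fin d → ℝ)
    (φ : (Fin d → ℤ) → ℝ) (x : Fin d → ℤ) :
    ∃ α ∈ dirs d, ham τ p φ x = (-(φ (x + α) - φ x) - pdot p α) / τ x α :=
  Set.Nonempty.csSup_mem
    (s := {r : ℝ | ∃ α ∈ dirs d, r = (-(φ (x + α) - φ x) - pdot p α) / τ x α})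
    ⟨_, _, single_mem_dirs ⟨0, hd⟩, rfl⟩ (finite_ham_set τ p φ x)

/-- Each direction contributes a lower bound for the discrete Hamiltonian. -/
theorem le_ham {d : ℕ} (τ : (Fin d → ℤ) → (Fin d → ℤ) → ℝ) (p : Fin d → ℝ)
    (φ : (Fin d → ℤ) → ℝ) (x : Fin d → ℤ) {α : Fin d → ℤ} (hα : α ∈ dirs d) :
    (-(φ (x + α) - φ x) - pdot p α) / τ x α ≤ ham τ p φ x :=
  le_csSup (finite_ham_set τ p φ x).bddAbove ⟨α, hα, rfl⟩

/-- If the lattice vectors `u` and `v` both act on the increments of `φ` by the ergodic map `V`, then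
the mean-zero increments of `φ` from the origin along `u` and along `v` agree almost everywhere. -/
theorem increment_ae_eq {d : ℕ} {Ω : Type*} [MeasurableSpace Ω] {P : Measure Ω}
    [IsProbabilityMeasure P] {V : Ω → Ω} (hVerg : Ergodic V P)
    {φ : (Fin d → ℤ) → Ω → ℝ} {u v : Fin d → ℤ}
    (hu : ∀ᵐ ω ∂P, φ (u + v) ω - φ u ω = φ v (V ω) - φ 0 (V ω))
    (hv : ∀ᵐ ω ∂P, φ (v + u) ω - φ v ω = φ u (V ω) - φ 0 (V ω))
    (hui : Integrable (fun ω => φ u ω - φ 0 ω) P)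
    (hvi : Integrable (fun ω => φ v ω - φ 0 ω) P)
    (hu0 : ∫ ω, (φ u ω - φ 0 ω) ∂P = 0) (hv0 : ∫ ω, (φ v ω - φ 0 ω) ∂P = 0) :
    ∀ᵐ ω ∂P, φ v ω - φ 0 ω = φ u ω - φ 0 ω := by
  set g : Ω → ℝ := fun ω => (φ v ω - φ 0 ω) - (φ u ω - φ 0 ω) with hg
  have hgi : Integrable g P := hvi.sub hui
  have hinv : g ∘ V =ᵐ[P] g := by
    filter_upwards [hu, hv] with ω h1 h2
    rw [add_comm v u] at h2
    simp only [hg, Function.comp]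
    linarith
  obtain ⟨c, hc⟩ := hVerg.ae_eq_const_of_ae_eq_comp_ae hgi.aestronglyMeasurable hinv
  have hint : ∫ ω, g ω ∂P = 0 := by
    rw [hg, integral_sub hvi hui, hu0, hv0, sub_zero]
  have hc0 : c = 0 := by
    rw [integral_congr_ae hc] at hint
    simpa using hint
  filter_upwards [hc] with ω h
  simp only [hg, hc0, Function.const_apply] at h
  linarith

/-- simplified variational expression under the symmetry assumption.
For undirected stationary edge-weights with `ℤ^d`-action `z ↦ V^{z_1+⋯+z_d}` and any
`φ ∈ S`, writing `f(ω) = φ(e_1,ω) − φ(0,ω)`,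
`esssup_ω sup_x 𝓗(φ,p,x,ω) = esssup_ω max_i |f(ω) + p·e_i| / τ(0,e_i,ω)`. -/
theorem stmt13 {d : ℕ} (hd : 1 ≤ d) {a b : ℝ} (ha : 0 < a) (hab : a ≤ b)
    {Ω : Type*} [MeasurableSpace Ω] (P : Measure Ω) [IsProbabilityMeasure P]
    (V : Ω → Ω) (W : ℤ → Ω → Ω)
    (hW1 : W 1 = V) (hW0 : W 0 = id) (hWadd : ∀ m n, W (m + n) = W m ∘ W n)
    (hWmp : ∀ n, MeasurePreserving (W n) P P)
    (hVerg : Ergodic V P)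
    (τ : (Fin d → ℤ) → (Fin d → ℤ) → Ω → ℝ)
    (hτmeas : ∀ x α, Measurable (τ x α))
    (hτstat : ∀ x z α, ∀ᵐ ω ∂P, τ (x + z) α ω = τ x α (W (∑ i, z i) ω))
    (hτundir : ∀ x, ∀ α ∈ dirs d, ∀ᵐ ω ∂P, τ x α ω = τ (x + α) (-α) ω)
    (hτbd : ∀ᵐ ω ∂P, ∀ x, ∀ α ∈ dirs d, a ≤ τ x α ω ∧ τ x α ω ≤ b)
    (p : Fin d → ℝ)
    (φ : (Fin d → ℤ) → Ω → ℝ)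
    (hφmeas : ∀ x, Measurable (φ x))
    (hφstat : ∀ x z α : Fin d → ℤ, ∀ᵐ ω ∂P,
      φ (x + z + α) ω - φ (x + z) ω
        = φ (x + α) (W (∑ i, z i) ω) - φ x (W (∑ i, z i) ω))
    (hφint : ∀ x α, Integrable (fun ω => φ (x + α) ω - φ x ω) P)
    (hφmean : ∀ x α, ∫ ω, (φ (x + α) ω - φ x ω) ∂P = 0) :
    essSup (fun ω => ⨆ x : Fin d → ℤ,
        ((ham (fun y α => τ y α ω) p (fun y => φ y ω) x : ℝ) : EReal)) P
      = essSup (fun ω =>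
        ((sSup {r : ℝ | ∃ i : Fin d,
          r = |(φ (Pi.single (⟨0, hd⟩ : Fin d) 1) ω - φ 0 ω) + pdot p (Pi.single i 1)| /
                τ 0 (Pi.single i 1) ω} : ℝ) : EReal)) P := by
  set e : Fin d → Fin d → ℤ := fun i => Pi.single i 1 with he
  have hsum : ∀ i, ∑ j, e i j = 1 := fun i => by simp [he]
  set i₀ : Fin d := ⟨0, hd⟩
  have hinc : ∀ᵐ ω ∂P, ∀ i, φ (e i) ω - φ 0 ω = φ (e i₀) ω - φ 0 ω := by
    rw [ae_all_iff]
    intro i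
    have hst : ∀ j k, ∀ᵐ ω ∂P, φ (e j + e k) ω - φ (e j) ω = φ (e k) (V ω) - φ 0 (V ω) := by
      intro j k
      have h := hφstat 0 (e j) (e k)
      simpa only [zero_add, hsum, hW1] using h
    have hi : ∀ j, Integrable (fun ω => φ (e j) ω - φ 0 ω) P := fun j => by
      simpa only [zero_add] using hφint 0 (e j)
    have hm : ∀ j, ∫ ω, (φ (e j) ω - φ 0 ω) ∂P = 0 := fun j => by
      simpa only [zero_add] using hφmean 0 (e j)
    exact increment_ae_eq hVerg (hst i₀ i) (hst i i₀) (hi i₀) (hi i) (hm i₀) (hm i)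
  have hundir : ∀ᵐ ω ∂P, ∀ x i, τ (x + e i) (-e i) ω = τ x (e i) ω := by
    simp only [ae_all_iff]
    intro x i
    filter_upwards [hτundir x (e i) (single_mem_dirs i)] with ω h using h.symm
  set S : Ω → Set ℝ := fun ω => {r : ℝ | ∃ i : Fin d,
    r = |(φ (e i₀) ω - φ 0 ω) + pdot p (e i)| / τ 0 (e i) ω}
  have hSfin : ∀ ω, (S ω).Finite := fun ω => by
    refine (Set.finite_range fun i : Fin d =>
      |(φ (e i₀) ω - φ 0 ω) + pdot p (e i)| / τ 0 (e i) ω).subset ?_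
    rintro r ⟨i, rfl⟩
    exact ⟨i, rfl⟩
  change essSup _ P = essSup (fun ω => ((sSup (S ω) : ℝ) : EReal)) P
  apply le_antisymm
  · have hbound : ∀ᵐ ω ∂P, ∀ n : ℤ, ((sSup (S (W n ω)) : ℝ) : EReal)
        ≤ essSup (fun ω => ((sSup (S ω) : ℝ) : EReal)) P := by
      rw [ae_all_iff]
      exact fun n => (hWmp n).quasiMeasurePreserving.ae
        (ae_le_essSup (f := fun ω => ((sSup (S ω) : ℝ) : EReal)))
    have hincW : ∀ᵐ ω ∂P, ∀ (n : ℤ) (i : Fin d),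
        φ (e i) (W n ω) - φ 0 (W n ω) = φ (e i₀) (W n ω) - φ 0 (W n ω) := by
      rw [ae_all_iff]
      exact fun n => (hWmp n).quasiMeasurePreserving.ae hinc
    have hφW : ∀ᵐ ω ∂P, ∀ (z : Fin d → ℤ) (i : Fin d), φ (z + e i) ω - φ z ω
        = φ (e i) (W (∑ j, z j) ω) - φ 0 (W (∑ j, z j) ω) := by
      simp only [ae_all_iff]
      intro z i
      simpa only [zero_add] using hφstat 0 z (e i)
    have hτW : ∀ᵐ ω ∂P, ∀ (z : Fin d → ℤ) (i : Fin d),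
        τ z (e i) ω = τ 0 (e i) (W (∑ j, z j) ω) := by
      simp only [ae_all_iff]
      intro z i
      simpa only [zero_add] using hτstat 0 z (e i)
    refine essSup_le_of_ae_le _ ?_
    filter_upwards [hbound, hincW, hφW, hτW, hundir, hτbd] with ω hb hI hφ' hτ' hu hbd
    have hedge : ∀ y i, |φ (y + e i) ω - φ y ω + pdot p (e i)| / τ y (e i) ω
        ≤ sSup (S (W (∑ j, y j) ω)) := fun y i =>
      le_csSup (hSfin _).bddAbove ⟨i, by rw [hφ', hI, hτ']⟩
    refine iSup_le fun x => ?_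
    have hham : ∃ n : ℤ, ham (fun y α => τ y α ω) p (fun y => φ y ω) x ≤ sSup (S (W n ω)) := by
      obtain ⟨α, hα, hr⟩ := exists_ham_eq hd (fun y α => τ y α ω) p (fun y => φ y ω) x
      rw [hr]
      obtain ⟨i, rfl | rfl⟩ := exists_of_mem_dirs hα
      · refine ⟨∑ j, x j, le_trans ?_ (hedge x i)⟩
        have hpos : 0 ≤ τ x (e i) ω := ha.le.trans (hbd x _ hα).1
        refine div_le_div_of_nonneg_right (le_trans (le_of_eq ?_) (neg_le_abs _)) hpos
        simp only [he]
        ring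
      · refine ⟨∑ j, (x - e i) j, le_trans ?_ (hedge (x - e i) i)⟩
        have h := hu (x - e i) i
        rw [sub_add_cancel] at h
        have hpos : 0 ≤ τ (x - e i) (e i) ω := ha.le.trans (hbd _ _ (single_mem_dirs i)).1
        change (-(φ (x + -e i) ω - φ x ω) - pdot p (-e i)) / τ x (-e i) ω ≤ _
        rw [h, sub_add_cancel, pdot_neg, ← sub_eq_add_neg x]
        refine div_le_div_of_nonneg_right (le_trans (le_of_eq ?_) (le_abs_self _)) hpos
        ring
    obtain ⟨n, hn⟩ := hham
    exact (EReal.coe_le_coe_iff.2 hn).trans (hb n)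
  · refine essSup_mono_ae ?_
    filter_upwards [hinc, hundir] with ω hI hu
    obtain ⟨i, hi⟩ := Set.Nonempty.csSup_mem (s := S ω) ⟨_, i₀, rfl⟩ (hSfin ω)
    suffices h : ∃ x, sSup (S ω) ≤ ham (fun y α => τ y α ω) p (fun y => φ y ω) x by
      obtain ⟨x, hx⟩ := h
      exact (EReal.coe_le_coe_iff.2 hx).trans
        (le_iSup (fun x => ((ham (fun y α => τ y α ω) p (fun y => φ y ω) x : ℝ) : EReal)) x)
    rw [hi, ← hI i]
    rcases abs_choice (φ (e i) ω - φ 0 ω + pdot p (e i)) with h | h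
    · refine ⟨e i, le_trans (le_of_eq ?_) (le_ham _ _ _ _ (neg_single_mem_dirs i))⟩
      have h2 := hu 0 i
      rw [zero_add] at h2
      change _ = (-(φ (e i + -e i) ω - φ (e i) ω) - pdot p (-e i)) / τ (e i) (-e i) ω
      rw [h, h2, pdot_neg, add_neg_cancel]
      ring
    · refine ⟨0, le_trans (le_of_eq ?_) (le_ham _ _ _ _ (single_mem_dirs i))⟩
      change _ = (-(φ (0 + e i) ω - φ 0 ω) - pdot p (e i)) / τ 0 (e i) ω
      rw [h, zero_add]
      ring
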